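/- Let 1 < p ≤ 3/2. Then the only nonnegative weak solution of the self-similar profile problem is the zero function: if ω ∈ H¹_K(ℝ₊) is nonnegative almost everywhere and satisfies ∫₀^∞ (ω'ζ' − ωζ/(2(p−1))) K dη + ω(0)^p ζ(0) = 0 for every ζ ∈ H¹_K(ℝ₊), then ω = 0 almost everywhere on (0,∞). -/

import Mathlib

open MeasureTheory Real Set

noncomputable def Kw (η : ℝ) : ℝ := Real.exp (η ^ 2 / 4)

/-- An element of the weighted Sobolev space `H¹_K(ℝ₊)`, represented by its
(absolutely) continuous representative on `[0,∞)` together with its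
distributional derivative, both square integrable against the weight `K`. -/
structure H1K where
  toFun : ℝ → ℝ
  deriv' : ℝ → ℝ
  absCont : ∀ x : ℝ, 0 ≤ x → toFun x = toFun 0 + ∫ t in (0:ℝ)..x, deriv' t
  memL2 : Integrable (fun η => (toFun η) ^ 2 * Kw η) (volume.restrict (Ioi (0:ℝ)))
  derivMemL2 : Integrable (fun η => (deriv' η) ^ 2 * Kw η) (volume.restrict (Ioi (0:ℝ)))

open Filter Topology

lemma Kw_pos (x : ℝ) : 0 < Kw x := Real.exp_pos _

lemma Kw_one_le (x : ℝ) : 1 ≤ Kw x := Real.one_le_exp (by positivity)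

lemma Kw_cont : Continuous Kw := by unfold Kw; fun_prop

/-- Product integrability. -/
lemma prod_int {f g : ℝ → ℝ} {μ : Measure ℝ} (hf : AEStronglyMeasurable f μ)
    (hg : AEStronglyMeasurable g μ)
    (hf2 : Integrable (fun x => f x ^ 2 * Kw x) μ) (hg2 : Integrable (fun x => g x ^ 2 * Kw x) μ) :
    Integrable (fun x => f x * g x * Kw x) μ := by
  refine (hf2.add hg2).mono' ((hf.mul hg).mul Kw_cont.aestronglyMeasurable) ?_
  filter_upwards with x
  have hk := Kw_pos x
  simp only [Pi.add_apply, norm_mul, Real.norm_eq_abs, abs_of_pos hk]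
  rw [← add_mul]
  refine mul_le_mul_of_nonneg_right ?_ hk.le
  nlinarith [sq_nonneg (|f x| - |g x|), sq_abs (f x), sq_abs (g x), sq_nonneg (f x), sq_nonneg (g x)]

lemma gauss_int (n : ℕ) : Integrable (fun x : ℝ => x ^ n * Real.exp (-(x ^ 2 / 4))) := by
  have h := integrable_rpow_mul_exp_neg_mul_sq (b := 1/4) (by norm_num) (s := n) 
    (by have : (0:ℝ) ≤ n := by positivity
        linarith)
  refine h.congr ?_
  filter_upwards with x
  simp only [Real.rpow_natCast]
  congr 2
  ring

/-- Dirichlet eigenfunction. -/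
noncomputable def zetaD : H1K where
  toFun x := x * Real.exp (-(x ^ 2 / 4))
  deriv' x := (1 - x ^ 2 / 2) * Real.exp (-(x ^ 2 / 4))
  absCont x _ := by
    have : ∀ t ∈ uIcc 0 x, HasDerivAt (fun x : ℝ => x * Real.exp (-(x ^ 2 / 4)))
        ((1 - t ^ 2 / 2) * Real.exp (-(t ^ 2 / 4))) t := by
      intro t _
      have h := (hasDerivAt_id t).mul ((((hasDerivAt_id t).pow 2).div_const 4).neg.exp)
      refine h.congr_deriv ?_
      simp
      ring
    rw [intervalIntegral.integral_eq_sub_of_hasDerivAt this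
      (Continuous.intervalIntegrable (by fun_prop) _ _)]
    simp
  memL2 := by
    refine ((gauss_int 2).restrict (s := Ioi 0)).congr ?_
    filter_upwards with x
    have : Real.exp (-(x ^ 2 / 4)) * Kw x = 1 := by
      rw [Kw, ← Real.exp_add]; simp
    linear_combination -(x ^ 2 * Real.exp (-(x ^ 2 / 4))) * this
  derivMemL2 := by
    refine ((((gauss_int 0).sub (gauss_int 2)).add ((gauss_int 4).div_const 4)).restrict
      (s := Ioi 0)).congr ?_
    filter_upwards with x
    have : Real.exp (-(x ^ 2 / 4)) * Kw x = 1 := by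
      rw [Kw, ← Real.exp_add]; simp
    simp only [Pi.add_apply, Pi.sub_apply]
    linear_combination -((1 - x ^ 2 / 2) ^ 2 * Real.exp (-(x ^ 2 / 4))) * this

noncomputable def dT (b : ℝ) : ℝ → ℝ := (Iic b).indicator (fun t => -(Kw t)⁻¹)

lemma Kinv_cont : Continuous (fun t => -(Kw t)⁻¹) :=
  (Kw_cont.inv₀ (fun x => (Kw_pos x).ne')).neg

lemma dT_int (b u v : ℝ) : IntervalIntegrable (dT b) volume u v := by
  have := (Kinv_cont.intervalIntegrable u v (μ := volume))
  rw [intervalIntegrable_iff] at this ⊢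
  exact this.indicator measurableSet_Iic

noncomputable def fT (b : ℝ) (x : ℝ) : ℝ := -∫ t in x..b, dT b t

lemma fT_zero (b x : ℝ) (h : b ≤ x) : fT b x = 0 := by
  unfold fT
  rw [intervalIntegral.integral_symm, neg_neg, intervalIntegral.integral_of_le h]
  apply setIntegral_eq_zero_of_forall_eq_zero
  intro t ht
  simp [dT, ht.1]

lemma fT_nonneg (b x : ℝ) : 0 ≤ fT b x := by
  rcases le_total b x with h | h
  · rw [fT_zero b x h]
  · unfold fT
    rw [← intervalIntegral.integral_neg]
    apply intervalIntegral.integral_nonneg h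
    intro t ht
    simp [dT, ht.2, (Kw_pos t).le]

lemma fT_cont (b : ℝ) : Continuous (fT b) := by
  have : fT b = fun x => ∫ t in b..x, dT b t := by
    ext x
    rw [fT, intervalIntegral.integral_symm, neg_neg]
  rw [this]
  exact intervalIntegral.continuous_primitive (dT_int b) b

lemma compact_int {g : ℝ → ℝ} (b : ℝ) (hb : 0 ≤ b)
    (hg : ContinuousOn g (Icc 0 b)) (h0 : ∀ x, b < x → g x = 0) :
    Integrable g (volume.restrict (Ioi (0:ℝ))) := by
  change IntegrableOn g (Ioi 0)
  rw [← Ioc_union_Ioi_eq_Ioi hb]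
  refine IntegrableOn.union ?_ ?_
  · exact (hg.integrableOn_Icc).mono_set Ioc_subset_Icc_self
  · exact integrableOn_zero.congr_fun (fun x hx => (h0 x hx).symm) measurableSet_Ioi

noncomputable def zetaT (b : ℝ) (hb : 0 ≤ b) : H1K where
  toFun := fT b
  deriv' := dT b
  absCont x _ := by
    have := intervalIntegral.integral_add_adjacent_intervals (dT_int b 0 x) (dT_int b x b)
    unfold fT
    linarith
  memL2 := compact_int b hb (((fT_cont b).pow 2).mul Kw_cont).continuousOn
    (fun x hx => by simp [fT_zero b x hx.le])
  derivMemL2 := by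
    refine compact_int b hb ?_ (fun x hx => by simp [dT, hx])
    refine ((Kinv_cont.pow 2).mul Kw_cont).continuousOn.congr ?_
    intro x hx
    simp [dT, hx.2]

lemma parts {f : ℝ → ℝ} {b : ℝ} (hf : IntervalIntegrable f volume 0 b) :
    ∫ x in (0:ℝ)..b, (1 - x ^ 2 / 2) * f x
      = (1 - b ^ 2 / 2) * (∫ t in (0:ℝ)..b, f t) + ∫ x in (0:ℝ)..b, x * ∫ t in (0:ℝ)..x, f t := by
  have hF := hf.absolutelyContinuousOnInterval_intervalIntegral (c := 0) (by simp)
  have hD : ∀ x : ℝ, HasDerivAt (fun x : ℝ => 1 - x ^ 2 / 2) (-x) x := by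
    intro x
    have h := (((hasDerivAt_id x).pow 2).div_const 2).const_sub 1
    refine h.congr_deriv ?_
    simp
  have hG : AbsolutelyContinuousOnInterval (fun x : ℝ => 1 - x ^ 2 / 2) 0 b := by
    have hc : ContDiff ℝ 1 (fun x : ℝ => 1 - x ^ 2 / 2) := by fun_prop
    exact hc.contDiffOn.absolutelyContinuousOnInterval
  have h := hG.integral_mul_deriv_eq_deriv_mul hF
  have e1 : ∫ x in (0:ℝ)..b, (1 - x ^ 2 / 2) * deriv (fun x => ∫ v in (0:ℝ)..x, f v) x
      = ∫ x in (0:ℝ)..b, (1 - x ^ 2 / 2) * f x := by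
    apply intervalIntegral.integral_congr_ae
    filter_upwards [hf.ae_hasDerivAt_integral] with x hx hxm
    rw [(hx (uIoc_subset_uIcc hxm) 0 (by simp)).deriv]
  rw [e1] at h
  rw [h]
  simp only [(hD _).deriv, neg_mul, intervalIntegral.integral_neg, intervalIntegral.integral_same]
  ring

lemma toFun_meas (ω : H1K) (hnn : ∀ᵐ η ∂(volume.restrict (Ioi (0:ℝ))), 0 ≤ ω.toFun η) :
    AEStronglyMeasurable ω.toFun (volume.restrict (Ioi (0:ℝ))) := by
  have h1 : AEStronglyMeasurable (fun η => Real.sqrt ((ω.toFun η) ^ 2 * Kw η * (Kw η)⁻¹))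
      (volume.restrict (Ioi (0:ℝ))) :=
    Real.continuous_sqrt.comp_aestronglyMeasurable (ω.memL2.aestronglyMeasurable.mul
      (Kw_cont.inv₀ (fun x => (Kw_pos x).ne')).aestronglyMeasurable)
  refine h1.congr ?_
  filter_upwards [hnn] with x hx
  rw [mul_assoc, mul_inv_cancel₀ (Kw_pos x).ne', mul_one, Real.sqrt_sq hx]

/-- If the derivative is not locally integrable, the value at zero vanishes. -/
lemma zero_of_bad (ω : H1K) (b : ℝ) (hb : 0 ≤ b)
    (h : ¬ IntervalIntegrable ω.deriv' volume 0 b) : ω.toFun 0 = 0 := by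
  by_contra h0
  have hc : ∀ x ∈ Ioi b, ω.toFun x = ω.toFun 0 := by
    intro x hx
    have hx' : b ≤ x := le_of_lt hx
    rw [ω.absCont x (hb.trans hx'), intervalIntegral.integral_undef, add_zero]
    intro hi
    apply h
    refine hi.mono_set ?_
    rw [uIcc_of_le hb, uIcc_of_le (hb.trans hx')]
    exact Icc_subset_Icc_right hx'
  have h1 : IntegrableOn (fun _ : ℝ => ω.toFun 0 ^ 2) (Ioi b) := by
    have h2 : IntegrableOn (fun η => (ω.toFun η) ^ 2 * Kw η) (Ioi b) :=
      IntegrableOn.mono_set (t := Ioi (0:ℝ)) ω.memL2 (Ioi_subset_Ioi hb)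
    refine Integrable.mono' h2 aestronglyMeasurable_const ?_
    filter_upwards [ae_restrict_mem measurableSet_Ioi] with x hx
    rw [hc x hx, Real.norm_eq_abs, abs_of_nonneg (sq_nonneg _)]
    nlinarith [Kw_one_le x, sq_nonneg (ω.toFun 0)]
  rw [integrableOn_const_iff] at h1
  simp [h0] at h1

lemma deriv_meas (ω : H1K) (h : ∀ b, 0 ≤ b → IntervalIntegrable ω.deriv' volume 0 b) :
    AEStronglyMeasurable ω.deriv' (volume.restrict (Ioi (0:ℝ))) := by
  have : Ioi (0:ℝ) = ⋃ n : ℕ, Ioc (0:ℝ) n := by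
    ext x
    simp only [mem_Ioi, mem_iUnion, mem_Ioc]
    constructor
    · intro hx
      obtain ⟨n, hn⟩ := exists_nat_ge x
      exact ⟨n, hx, hn⟩
    · rintro ⟨n, hx, _⟩
      exact hx
  rw [this, aestronglyMeasurable_iUnion_iff]
  intro n
  have hn := h n (by positivity)
  rw [intervalIntegrable_iff_integrableOn_Ioc_of_le (by positivity)] at hn
  exact hn.aestronglyMeasurable

lemma exp_mul_Kw (x : ℝ) : Real.exp (-(x ^ 2 / 4)) * Kw x = 1 := by
  rw [Kw, ← Real.exp_add]; simp

lemma value_zero_nonpos (l : ℝ) (hl : 0 < l) (hl1 : l ≤ 1) (c : ℝ) (ω : H1K)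
    (hnn : ∀ᵐ η ∂(volume.restrict (Ioi (0:ℝ))), 0 ≤ ω.toFun η)
    (hω : ∀ ζ : H1K,
      (∫ η in Ioi (0:ℝ),
          (ω.deriv' η * ζ.deriv' η - ω.toFun η * ζ.toFun η / l) * Kw η)
        + c * ζ.toFun 0 = 0)
    (h : ∀ b, 0 ≤ b → IntervalIntegrable ω.deriv' volume 0 b) :
    ω.toFun 0 ≤ 0 := by
  have hm := toFun_meas ω hnn
  have hdm := deriv_meas ω h
  have i1 : IntegrableOn (fun x => (1 - x ^ 2 / 2) * ω.deriv' x) (Ioi 0) := by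
    refine (prod_int hdm (g := zetaD.deriv') ?_ ω.derivMemL2 zetaD.derivMemL2).congr ?_
    · exact Continuous.aestronglyMeasurable (by unfold zetaD; fun_prop)
    · filter_upwards with x
      simp only [zetaD]
      linear_combination ω.deriv' x * (1 - x ^ 2 / 2) * exp_mul_Kw x
  have i2 : IntegrableOn (fun x => x * ω.toFun x) (Ioi 0) := by
    refine (prod_int hm (g := zetaD.toFun) ?_ ω.memL2 zetaD.memL2).congr ?_
    · exact Continuous.aestronglyMeasurable (by unfold zetaD; fun_prop)
    · filter_upwards with x
      simp only [zetaD]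
      linear_combination ω.toFun x * x * exp_mul_Kw x
  have key : (∫ x in Ioi (0:ℝ), (1 - x ^ 2 / 2) * ω.deriv' x)
      = (∫ x in Ioi (0:ℝ), x * ω.toFun x) / l := by
    have h1 := hω zetaD
    have h2 : ∀ x, (ω.deriv' x * zetaD.deriv' x - ω.toFun x * zetaD.toFun x / l) * Kw x
        = (1 - x ^ 2 / 2) * ω.deriv' x - x * ω.toFun x / l := by
      intro x
      simp only [zetaD]
      linear_combination (ω.deriv' x * (1 - x ^ 2 / 2) - ω.toFun x * x / l) * exp_mul_Kw x
    simp only [h2] at h1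
    rw [integral_sub i1 (i2.div_const l), integral_div] at h1
    have h3 : zetaD.toFun 0 = 0 := by simp [zetaD]
    rw [h3] at h1
    linarith
  have hpos : 0 ≤ ∫ x in Ioi (0:ℝ), x * ω.toFun x := by
    apply integral_nonneg_of_ae
    filter_upwards [hnn, ae_restrict_mem measurableSet_Ioi] with x hx hx0
    exact mul_nonneg (le_of_lt hx0) hx
  have t1 := intervalIntegral_tendsto_integral_Ioi 0 i1 tendsto_id
  have t2 := intervalIntegral_tendsto_integral_Ioi 0 i2 tendsto_id
  have t3 := t2.sub t1
  have hfr : ∃ᶠ b : ℝ in atTop, ω.toFun 0 ≤ (∫ x in (0:ℝ)..id b, x * ω.toFun x)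
      - ∫ x in (0:ℝ)..id b, (1 - x ^ 2 / 2) * ω.deriv' x := by
    rw [frequently_atTop]
    intro a
    obtain ⟨b, hb1, hb2⟩ : ∃ b, max a 2 < b ∧ 0 ≤ ω.toFun b := by
      by_contra hcon
      push Not at hcon
      have h1 : ∀ᵐ η ∂(volume.restrict (Ioi (max a 2))), 0 ≤ ω.toFun η :=
        ae_restrict_of_ae_restrict_of_subset
          (Ioi_subset_Ioi (by simp)) hnn
      have h2 : ∀ᵐ η ∂(volume.restrict (Ioi (max a 2))), False := by
        filter_upwards [h1, ae_restrict_mem measurableSet_Ioi] with x hx hx2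
        exact absurd hx (not_le.mpr (hcon x hx2))
      rw [ae_iff] at h2
      simp at h2
    have hb2' : 2 < b := lt_of_le_of_lt (le_max_right _ _) hb1
    have hb0 : 0 ≤ b := by linarith
    refine ⟨b, (lt_of_le_of_lt (le_max_left _ _) hb1).le, ?_⟩
    have hF := (h b hb0).absolutelyContinuousOnInterval_intervalIntegral (c := 0) (by simp)
    have e : ∫ x in (0:ℝ)..b, x * ω.toFun x
        = ω.toFun 0 * (b ^ 2 / 2) + ∫ x in (0:ℝ)..b, x * ∫ t in (0:ℝ)..x, ω.deriv' t := by
      have e1 : ∫ x in (0:ℝ)..b, x * ω.toFun x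
          = ∫ x in (0:ℝ)..b, (x * ω.toFun 0 + x * ∫ t in (0:ℝ)..x, ω.deriv' t) := by
        apply intervalIntegral.integral_congr
        intro x hx
        rw [uIcc_of_le hb0] at hx
        simp only
        rw [ω.absCont x hx.1, mul_add]
      rw [e1, intervalIntegral.integral_add]
      · rw [intervalIntegral.integral_mul_const, integral_id]
        ring
      · exact Continuous.intervalIntegrable (by fun_prop) _ _
      · exact ContinuousOn.intervalIntegrable (continuousOn_id.mul hF.continuousOn)
    have hp := parts (h b hb0)
    have ha := ω.absCont b hb0
    simp only [id]
    rw [e, hp]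
    rw [ha] at hb2
    nlinarith [mul_nonneg hb2 (show (0:ℝ) ≤ b ^ 2 / 2 - 1 by nlinarith)]
  have hle := ge_of_tendsto_of_frequently t3 hfr
  rw [key] at hle
  have : (∫ x in Ioi (0:ℝ), x * ω.toFun x) ≤ (∫ x in Ioi (0:ℝ), x * ω.toFun x) / l := by
    rw [le_div_iff₀ hl]
    nlinarith
  linarith

lemma value_nonpos (l : ℝ) (hl : 0 < l) (ω : H1K)
    (hnn : ∀ᵐ η ∂(volume.restrict (Ioi (0:ℝ))), 0 ≤ ω.toFun η)
    (hω : ∀ ζ : H1K,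
      (∫ η in Ioi (0:ℝ),
          (ω.deriv' η * ζ.deriv' η - ω.toFun η * ζ.toFun η / l) * Kw η) = 0)
    (h0 : ω.toFun 0 = 0) (b : ℝ) (hb : 0 ≤ b)
    (h : IntervalIntegrable ω.deriv' volume 0 b) :
    ω.toFun b ≤ 0 := by
  have hm := toFun_meas ω hnn
  have h1 := hω (zetaT b hb)
  have h2 : ∀ x, (ω.deriv' x * (zetaT b hb).deriv' x - ω.toFun x * (zetaT b hb).toFun x / l) * Kw x
      = (Iic b).indicator (fun t => -ω.deriv' t) x - ω.toFun x * fT b x * Kw x / l := by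
    intro x
    have hk := (Kw_pos x).ne'
    by_cases hx : x ≤ b
    · simp only [zetaT, dT, indicator_of_mem (mem_Iic.mpr hx)]
      field_simp
    · simp only [zetaT, dT, indicator_of_notMem (fun h => hx (mem_Iic.mp h))]
      ring
  simp only [h2] at h1
  have i2 : Integrable (fun x => ω.toFun x * fT b x * Kw x) (volume.restrict (Ioi (0:ℝ))) :=
    prod_int hm (fT_cont b).aestronglyMeasurable ω.memL2 (zetaT b hb).memL2
  have h' := h
  rw [intervalIntegrable_iff_integrableOn_Ioc_of_le hb] at h'
  have i1 : Integrable ((Iic b).indicator (fun t => -ω.deriv' t)) (volume.restrict (Ioi (0:ℝ))) := by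
    rw [integrable_indicator_iff measurableSet_Iic, IntegrableOn,
      Measure.restrict_restrict measurableSet_Iic, inter_comm, Ioi_inter_Iic]
    exact h'.neg
  rw [integral_sub i1 (i2.div_const l), integral_div, integral_indicator measurableSet_Iic,
    Measure.restrict_restrict measurableSet_Iic, inter_comm, Ioi_inter_Iic, integral_neg,
    ← intervalIntegral.integral_of_le hb] at h1
  have hpos : 0 ≤ (∫ x in Ioi (0:ℝ), ω.toFun x * fT b x * Kw x) / l := by
    refine div_nonneg (integral_nonneg_of_ae ?_) hl.le
    filter_upwards [hnn] with x hx
    exact mul_nonneg (mul_nonneg hx (fT_nonneg b x)) (Kw_pos x).le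
  rw [ω.absCont b hb, h0]
  linarith

theorem profile_nonneg_trivial_of_p_le (p : ℝ) (hp1 : 1 < p) (hp2 : p ≤ 3 / 2)
    (ω : H1K)
    (hnn : ∀ᵐ η ∂(volume.restrict (Ioi (0:ℝ))), 0 ≤ ω.toFun η)
    (hω : ∀ ζ : H1K,
      (∫ η in Ioi (0:ℝ),
          (ω.deriv' η * ζ.deriv' η - ω.toFun η * ζ.toFun η / (2 * (p - 1))) * Kw η)
        + (ω.toFun 0) ^ p * ζ.toFun 0 = 0) :
    ∀ᵐ η ∂(volume.restrict (Ioi (0:ℝ))), ω.toFun η = 0 := by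
  have hl : 0 < 2 * (p - 1) := by linarith
  have hl1 : 2 * (p - 1) ≤ 1 := by linarith
  have h0 : ω.toFun 0 = 0 := by
    by_cases h : ∀ b, 0 ≤ b → IntervalIntegrable ω.deriv' volume 0 b
    · have hle := value_zero_nonpos _ hl hl1 _ ω hnn hω h
      refine le_antisymm hle ?_
      have hc : ContinuousWithinAt ω.toFun (Ioi 0) 0 := by
        have hF := ((h 1 zero_le_one).absolutelyContinuousOnInterval_intervalIntegral (c := 0)
          (by simp)).continuousOn
        have hF2 : ContinuousOn ω.toFun (Icc 0 1) := by
          rw [uIcc_of_le zero_le_one] at hF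
          exact (hF.const_add (ω.toFun 0)).congr (fun x hx => ω.absCont x hx.1)
        exact (hF2 0 (by simp)).mono_of_mem_nhdsWithin
          (mem_of_superset (Ioc_mem_nhdsGT zero_lt_one) Ioc_subset_Icc_self)
      by_contra hneg
      push Not at hneg
      have hev : ∀ᶠ x in 𝓝[>] (0:ℝ), ω.toFun x < 0 := hc.eventually_lt_const hneg
      obtain ⟨u, hu, hsub⟩ := mem_nhdsGT_iff_exists_Ioo_subset.mp hev
      have h1 : ∀ᵐ η ∂(volume.restrict (Ioo 0 u)), 0 ≤ ω.toFun η :=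
        ae_restrict_of_ae_restrict_of_subset Ioo_subset_Ioi_self hnn
      have h2 : ∀ᵐ η ∂(volume.restrict (Ioo 0 u)), False := by
        filter_upwards [h1, ae_restrict_mem measurableSet_Ioo] with x hx hx2
        exact absurd hx (not_le.mpr (hsub hx2))
      rw [ae_iff] at h2
      simp at h2
      exact absurd (mem_Ioi.mp hu) (not_lt.mpr h2)
    · push Not at h
      obtain ⟨b, hb, hbad⟩ := h
      exact zero_of_bad ω b hb hbad
  have hω' : ∀ ζ : H1K,
      (∫ η in Ioi (0:ℝ),
          (ω.deriv' η * ζ.deriv' η - ω.toFun η * ζ.toFun η / (2 * (p - 1))) * Kw η) = 0 := by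
    intro ζ
    have := hω ζ
    rwa [h0, Real.zero_rpow (by linarith), zero_mul, add_zero] at this
  filter_upwards [hnn, ae_restrict_mem measurableSet_Ioi] with x hx hx0
  have hx0' : 0 ≤ x := le_of_lt hx0
  refine le_antisymm ?_ hx
  by_cases h : IntervalIntegrable ω.deriv' volume 0 x
  · exact value_nonpos _ hl ω hnn hω' h0 x hx0' h
  · rw [ω.absCont x hx0', intervalIntegral.integral_undef h, h0, add_zero]
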